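/- Fix an even integer N ≥ 2, a real number m > 1, an integer l with 1 ≤ l ≤ N, and a real number λ. Let (a_j) and (b_j) be the recursive sequences with a_0 = b_0 = 0 and, for j ≥ 1, a_j = (d_{N−2j+2} + a_{j−1} l²λ²)/(d_{N−2j+1} d_{N−2j+2} + a_{j−1} d_{N−2j+1} l²λ² + l²λ²) and b_j = (d_{2j−1} + b_{j−1} l²λ²)/(d_{2j} d_{2j−1} + b_{j−1} d_{2j} l²λ² + l²λ²). Then for every j = 0,…,N/2 − 1, setting k = (N − 2j − 2)/2, the 2×2 submatrix of (T^l_λ)^{−1} with row and column indices {N−2j−1, N−2j} equals the inverse of the 2×2 matrix with rows (d_{N−2j−1} + l²λ² b_k, −lλ) and (lλ, d_{N−2j} + l²λ² a_j). -/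

import Mathlib

/-- The `N × N` tridiagonal matrix `T^l_λ` with diagonal entries
`d_j = l^(2m) + (j-1)^(2m)` (so, in the 0-based indexing of `Fin N`,
the entry at `(j, j)` is `l^(2m) + j^(2m)`), superdiagonal entries `-lλ`
and subdiagonal entries `lλ`.  Here `x ^ (2*m)` is the real power. -/
noncomputable def Tmat (N : ℕ) (m : ℝ) (l : ℕ) (lam : ℝ) :
    Matrix (Fin N) (Fin N) ℝ :=
  Matrix.of fun j k =>
    if (j : ℕ) = (k : ℕ) then (l : ℝ) ^ (2 * m) + (j : ℕ) ^ (2 * m)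
    else if (j : ℕ) + 1 = (k : ℕ) then -((l : ℝ) * lam)
    else if (k : ℕ) + 1 = (j : ℕ) then (l : ℝ) * lam
    else 0

/-- `d_j = l^(2m) + (j-1)^(2m)` (1-based index `j ≥ 1`, natural subtraction,
real powers). -/
noncomputable def dseq (m : ℝ) (l : ℕ) (j : ℕ) : ℝ :=
  (l : ℝ) ^ (2 * m) + ((j - 1 : ℕ) : ℝ) ^ (2 * m)

/-- The recursive sequence `a_j`:  `a_0 = 0` and
`a_j = (d_{N-2j+2} + a_{j-1} l²λ²) /
       (d_{N-2j+1} d_{N-2j+2} + a_{j-1} d_{N-2j+1} l²λ² + l²λ²)`. -/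
noncomputable def aseq (m : ℝ) (l : ℕ) (N : ℕ) (lam : ℝ) : ℕ → ℝ
  | 0 => 0
  | j + 1 =>
      (dseq m l (N - 2 * (j + 1) + 2) + aseq m l N lam j * ((l : ℝ) * lam) ^ 2) /
        (dseq m l (N - 2 * (j + 1) + 1) * dseq m l (N - 2 * (j + 1) + 2)
          + aseq m l N lam j * dseq m l (N - 2 * (j + 1) + 1) * ((l : ℝ) * lam) ^ 2
          + ((l : ℝ) * lam) ^ 2)

/-- The recursive sequence `b_j`:  `b_0 = 0` and
`b_j = (d_{2j-1} + b_{j-1} l²λ²) /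
       (d_{2j} d_{2j-1} + b_{j-1} d_{2j} l²λ² + l²λ²)`. -/
noncomputable def bseq (m : ℝ) (l : ℕ) (lam : ℝ) : ℕ → ℝ
  | 0 => 0
  | j + 1 =>
      (dseq m l (2 * (j + 1) - 1) + bseq m l lam j * ((l : ℝ) * lam) ^ 2) /
        (dseq m l (2 * (j + 1)) * dseq m l (2 * (j + 1) - 1)
          + bseq m l lam j * dseq m l (2 * (j + 1)) * ((l : ℝ) * lam) ^ 2
          + ((l : ℝ) * lam) ^ 2)

theorem dseq_pos (m : ℝ) {l : ℕ} (hl : 1 ≤ l) (i : ℕ) : 0 < dseq m l i := by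
  have hl' : (0 : ℝ) < l := by exact_mod_cast hl
  unfold dseq
  positivity

theorem aseq_nonneg (m : ℝ) {l : ℕ} (hl : 1 ≤ l) (N : ℕ) (lam : ℝ) (j : ℕ) :
    0 ≤ aseq m l N lam j := by
  induction j with
  | zero => simp [aseq]
  | succ j ih =>
    have h₁ := dseq_pos m hl (N - 2 * (j + 1) + 1)
    have h₂ := dseq_pos m hl (N - 2 * (j + 1) + 2)
    rw [aseq]
    positivity

theorem bseq_nonneg (m : ℝ) {l : ℕ} (hl : 1 ≤ l) (lam : ℝ) (j : ℕ) :
    0 ≤ bseq m l lam j := by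
  induction j with
  | zero => simp [bseq]
  | succ j ih =>
    have h₁ := dseq_pos m hl (2 * (j + 1) - 1)
    have h₂ := dseq_pos m hl (2 * (j + 1))
    rw [bseq]
    positivity

theorem Tmat_add_transpose (N : ℕ) (m : ℝ) (l : ℕ) (lam : ℝ) :
    Tmat N m l lam + (Tmat N m l lam).transpose =
      Matrix.diagonal fun i : Fin N => 2 * dseq m l (i + 1) := by
  ext i k
  simp only [Matrix.add_apply, Matrix.transpose_apply, Tmat, Matrix.of_apply,
    Matrix.diagonal_apply, Fin.ext_iff, dseq, Nat.add_sub_cancel]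
  rcases eq_or_ne (i : ℕ) k with h | h
  · simp only [h, if_true]
    ring
  · rw [if_neg h, if_neg h.symm, if_neg h]
    split_ifs <;> first | omega | ring

theorem isUnit_det_Tmat (N : ℕ) (m : ℝ) {l : ℕ} (hl : 1 ≤ l) (lam : ℝ) :
    IsUnit (Tmat N m l lam).det := by
  rw [isUnit_iff_ne_zero]
  intro hdet
  obtain ⟨v, hv, hTv⟩ := Matrix.exists_mulVec_eq_zero_iff.2 hdet
  have hpos : (Matrix.diagonal fun i : Fin N => 2 * dseq m l (i + 1)).PosDef :=
    Matrix.PosDef.diagonal fun i => mul_pos two_pos (dseq_pos m hl _)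
  have h := hpos.dotProduct_mulVec_pos hv
  rw [← Tmat_add_transpose N m l lam, Matrix.add_mulVec, hTv, zero_add,
    Matrix.mulVec_transpose, star_trivial, dotProduct_comm, ← Matrix.dotProduct_mulVec, hTv,
    dotProduct_zero] at h
  exact h.false

/-- Rows of `Tmat` acting on a vector padded by zeros: the three-term recurrence. -/
theorem Tmat_mulVec_eq_recurrence (N : ℕ) (m : ℝ) (l : ℕ) (lam : ℝ) (y : ℕ → ℝ)
    (hy₀ : y 0 = 0) (hyN : y (N + 1) = 0) (r : Fin N) :
    ∑ i : Fin N, Tmat N m l lam r i * y (i + 1) =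
      (l * lam) * y r + dseq m l (r + 1) * y (r + 1) - (l * lam) * y (r + 2) := by
  obtain ⟨r, hr⟩ := r
  let f : ℕ → ℝ := fun i => (if i = r then dseq m l (r + 1) * y (r + 1) else 0)
    + (if i = r + 1 then -((l * lam) * y (r + 2)) else 0)
    + (if i + 1 = r then (l * lam) * y r else 0)
  have key : ∀ i : Fin N, Tmat N m l lam ⟨r, hr⟩ i * y (i + 1) = f i := by
    rintro ⟨i, hi⟩
    simp only [f, Tmat, Matrix.of_apply, dseq, Nat.add_sub_cancel]
    split_ifs <;> first | omega | (subst_vars; ring)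
  rw [Finset.sum_congr rfl fun i _ => key i, Fin.sum_univ_eq_sum_range f,
    Finset.sum_add_distrib, Finset.sum_add_distrib, Finset.sum_ite_eq', Finset.sum_ite_eq',
    if_pos (Finset.mem_range.2 hr)]
  have h₁ : (if r + 1 ∈ Finset.range N then -((l * lam) * y (r + 2)) else 0) =
      -((l * lam) * y (r + 2)) := by
    split_ifs with h
    · rfl
    · have : r + 2 = N + 1 := by
        rw [Finset.mem_range] at h
        omega
      rw [this, hyN]
      ring
  have h₂ : ∑ i ∈ Finset.range N, (if i + 1 = r then (l * lam) * y r else 0) =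
      (l * lam) * y r := by
    cases r with
    | zero => simp [hy₀]
    | succ r =>
      simp only [Nat.add_right_cancel_iff]
      rw [Finset.sum_ite_eq', if_pos (Finset.mem_range.2 (by omega))]
  rw [h₁, h₂]
  ring

/-- Elimination from the top of a solution of the three-term recurrence. -/
theorem recurrence_eq_bseq_mul (m : ℝ) {l : ℕ} (hl : 1 ≤ l) (lam : ℝ) (y : ℕ → ℝ)
    (hy₀ : y 0 = 0) (k : ℕ)
    (hrec : ∀ r < 2 * k,
      (l * lam) * y r + dseq m l (r + 1) * y (r + 1) - (l * lam) * y (r + 2) = 0) :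
    y (2 * k) = (l * lam) * bseq m l lam k * y (2 * k + 1) := by
  induction k with
  | zero => simp [hy₀, bseq]
  | succ k ih =>
    have ih := ih fun r hr => hrec r (by omega)
    have e₁ := hrec (2 * k) (by omega)
    have e₂ := hrec (2 * k + 1) (by omega)
    have h₁ := dseq_pos m hl (2 * k + 1)
    have h₂ := dseq_pos m hl (2 * k + 2)
    have hb := bseq_nonneg m hl lam k
    rw [bseq, show 2 * (k + 1) - 1 = 2 * k + 1 by omega, show 2 * (k + 1) = 2 * k + 2 by ring]
    rw [show 2 * k + 1 + 1 = 2 * k + 2 by ring, show 2 * k + 1 + 2 = 2 * k + 2 + 1 by ring] at e₂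
    generalize bseq m l lam k = b at *
    generalize (l : ℝ) * lam = c at *
    generalize dseq m l (2 * k + 1) = d₁ at *
    generalize dseq m l (2 * k + 2) = d₂ at *
    have hden : 0 < d₂ * d₁ + b * d₂ * c ^ 2 + c ^ 2 := by positivity
    rw [← mul_div_assoc, div_mul_eq_mul_div, eq_div_iff hden.ne']
    rw [ih] at e₁
    linear_combination (d₁ + b * c ^ 2) * e₂ - c * e₁

/-- Elimination from the bottom of a solution of the three-term recurrence. -/
theorem recurrence_eq_aseq_mul (m : ℝ) {l : ℕ} (hl : 1 ≤ l) (N : ℕ) (lam : ℝ) (y : ℕ → ℝ)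
    (hyN : y (N + 1) = 0) (j : ℕ) (hj : 2 * j ≤ N)
    (hrec : ∀ r < N, N - 2 * j ≤ r →
      (l * lam) * y r + dseq m l (r + 1) * y (r + 1) - (l * lam) * y (r + 2) = 0) :
    y (N - 2 * j + 1) = -((l * lam) * aseq m l N lam j * y (N - 2 * j)) := by
  induction j with
  | zero => simp [hyN, aseq]
  | succ j ih =>
    have ih := ih (by omega) fun r hr hr' => hrec r hr (by omega)
    obtain ⟨n, hn⟩ : ∃ n, N - 2 * (j + 1) = n := ⟨_, rfl⟩
    have e₁ := hrec n (by omega) (by omega)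
    have e₂ := hrec (n + 1) (by omega) (by omega)
    have h₁ := dseq_pos m hl (n + 1)
    have h₂ := dseq_pos m hl (n + 2)
    have ha := aseq_nonneg m hl N lam j
    rw [aseq, hn]
    rw [show N - 2 * j = n + 2 by omega] at ih
    rw [show n + 1 + 1 = n + 2 by ring, show n + 1 + 2 = n + 2 + 1 by ring] at e₂
    generalize aseq m l N lam j = a at *
    generalize (l : ℝ) * lam = c at *
    generalize dseq m l (n + 1) = d₁ at *
    generalize dseq m l (n + 2) = d₂ at *
    have hden : 0 < d₁ * d₂ + a * d₁ * c ^ 2 + c ^ 2 := by positivity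
    rw [← mul_div_assoc, div_mul_eq_mul_div, ← neg_div, eq_div_iff hden.ne']
    rw [ih] at e₂
    linear_combination (d₂ + a * c ^ 2) * e₁ + c * e₂

/-- for `j = 0, …, N/2 - 1` and `k = (N - 2j - 2)/2`, the `2 × 2`
submatrix of `(T^l_λ)⁻¹` with (1-based) row and column indices
`{N-2j-1, N-2j}` (0-based: `{N-2j-2, N-2j-1}`) equals the inverse of the
`2 × 2` matrix `!![d_{N-2j-1} + l²λ² b_k, -lλ; lλ, d_{N-2j} + l²λ² a_j]`. -/
theorem Tmat_inv_two_by_two_block (N : ℕ) (hN : 2 ≤ N) (hNeven : Even N)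
    (m : ℝ) (hm : 1 < m) (l : ℕ) (hl1 : 1 ≤ l) (hlN : l ≤ N) (lam : ℝ)
    (j : ℕ) (hj : j < N / 2) :
    ∀ p q : Fin 2,
      (Tmat N m l lam)⁻¹
          ⟨N - 2 * j - 2 + (p : ℕ), by have := p.isLt; omega⟩
          ⟨N - 2 * j - 2 + (q : ℕ), by have := q.isLt; omega⟩
        = (!![dseq m l (N - 2 * j - 1)
                + ((l : ℝ) * lam) ^ 2 * bseq m l lam ((N - 2 * j - 2) / 2),
              -((l : ℝ) * lam);
              (l : ℝ) * lam,
              dseq m l (N - 2 * j)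
                + ((l : ℝ) * lam) ^ 2 * aseq m l N lam j])⁻¹ p q := by
  obtain ⟨k, hk⟩ : ∃ k, N - 2 * j - 2 = 2 * k := by
    obtain ⟨M, rfl⟩ := hNeven
    exact ⟨M - j - 1, by omega⟩
  set M := !![dseq m l (N - 2 * j - 1)
                + ((l : ℝ) * lam) ^ 2 * bseq m l lam ((N - 2 * j - 2) / 2),
              -((l : ℝ) * lam);
              (l : ℝ) * lam,
              dseq m l (N - 2 * j)
                + ((l : ℝ) * lam) ^ 2 * aseq m l N lam j] with hM
  rw [show (N - 2 * j - 2) / 2 = k by omega, show N - 2 * j - 1 = 2 * k + 1 by omega,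
    show N - 2 * j = 2 * k + 2 by omega] at hM
  let e : Fin 2 → Fin N := fun p => ⟨N - 2 * j - 2 + (p : ℕ), by have := p.isLt; omega⟩
  suffices h : M * (Tmat N m l lam)⁻¹.submatrix e e = 1 by
    intro p q
    rw [Matrix.inv_eq_right_inv h]
    rfl
  have he : ∀ p, (e p : ℕ) = 2 * k + p := fun p => by simp only [e, hk]
  ext p q
  let y : ℕ → ℝ := fun r =>
    if h : 1 ≤ r ∧ r ≤ N then (Tmat N m l lam)⁻¹ ⟨r - 1, by omega⟩ (e q) else 0
  have hy₀ : y 0 = 0 := by simp [y]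
  have hyN : y (N + 1) = 0 := by simp [y]
  have hy : ∀ i : Fin N, y (i + 1) = (Tmat N m l lam)⁻¹ i (e q) := by
    intro i
    simp only [y]
    rw [dif_pos (by omega)]
    rfl
  have hrec : ∀ r < N, (l * lam) * y r + dseq m l (r + 1) * y (r + 1) - (l * lam) * y (r + 2) =
      if r = e q then 1 else 0 := by
    intro r hr
    have h := Tmat_mulVec_eq_recurrence N m l lam y hy₀ hyN ⟨r, hr⟩
    simp only [hy] at h
    rw [← Matrix.mul_apply, Matrix.mul_nonsing_inv _ (isUnit_det_Tmat N m hl1 lam),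
      Matrix.one_apply] at h
    simpa only [Fin.ext_iff] using h.symm
  have hq := q.isLt
  have hb := recurrence_eq_bseq_mul m hl1 lam y hy₀ k fun r hr => by
    rw [hrec r (by omega), if_neg (by rw [he]; omega)]
  have ha := recurrence_eq_aseq_mul m hl1 N lam y hyN j (by omega) fun r hr hr' => by
    rw [hrec r (by omega), if_neg (by rw [he]; omega)]
  rw [show N - 2 * j = 2 * k + 2 by omega] at ha
  have e₁ := hrec (2 * k) (by omega)
  have e₂ := hrec (2 * k + 1) (by omega)
  rw [hb, he] at e₁
  rw [show 2 * k + 1 + 2 = 2 * k + 2 + 1 by ring, ha, he] at e₂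
  have hS : ∀ p, (Tmat N m l lam)⁻¹.submatrix e e p q = y (2 * k + p + 1) := by
    intro p
    rw [Matrix.submatrix_apply, ← hy, he]
  have hone : (1 : Matrix (Fin 2) (Fin 2) ℝ) p q =
      if 2 * k + (p : ℕ) = 2 * k + q then 1 else 0 := by
    simp [Matrix.one_apply, Fin.ext_iff]
  rw [Matrix.mul_apply, Fin.sum_univ_two, hS, hS, hM, hone]
  obtain rfl | rfl : p = 0 ∨ p = 1 := by omega
  · simp only [Matrix.of_apply, Matrix.cons_val_zero, Matrix.cons_val_one, Fin.val_zero,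
      Fin.val_one, add_zero]
    rw [← e₁]
    ring
  · simp only [Matrix.of_apply, Matrix.cons_val_zero, Matrix.cons_val_one, Fin.val_zero,
      Fin.val_one, add_zero]
    rw [← e₂]
    ring
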